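/- Define R_{2,p}(x) = (B_p(x) arcsin(B_p(x)/A_p(x)) + sqrt(A_p(x)^2 - B_p(x)^2)) / C_p(x)^{3/2} with A_p, B_p, C_p as in the Bogomolny–Bohigas–Lebœuf formula for the p-th derivative. Then for each fixed positive integer n and real u, (n/p) · R_{2,p}(n(1 + 1/(2p) + u/p)) → 1/(1+4u^2)^{3/2} as p → ∞. -/

import Mathlib

open Real Filter intervalIntegral

lemma aux_cos_bound (y : ℝ) : |1 - Real.cos y - y ^ 2 / 2| ≤ y ^ 4 / 2 := by
  have h0 : 0 ≤ y ^ 2 := sq_nonneg y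
  by_cases h : |y| ≤ 1
  · have h1 := Real.cos_bound h
    have h2 : |y| ^ 4 = y ^ 4 := Even.pow_abs (by decide) y
    rw [h2] at h1
    rw [abs_le] at h1 ⊢
    have : 0 ≤ y ^ 4 := by positivity
    constructor <;> linarith [h1.1, h1.2]
  · push Not at h
    have h1 : 1 ≤ y ^ 2 := by
      rw [← sq_abs]; nlinarith
    have h2 := Real.one_sub_sq_div_two_le_cos (x := y)
    have h3 := Real.cos_le_one y
    rw [abs_le]
    constructor <;> nlinarith

lemma aux_sin_bound (y : ℝ) : |Real.sin y - y| ≤ 2 * y ^ 2 := by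
  by_cases h : |y| ≤ 1
  · have h1 := Real.sin_bound h
    have h2 : |y ^ 3 / 6| ≤ y ^ 2 := by
      rw [abs_div, abs_pow, ← sq_abs y, abs_of_pos (by norm_num : (0:ℝ) < 6)]
      have := abs_nonneg y
      nlinarith [mul_nonneg (sq_nonneg |y|) (sub_nonneg.2 h), sq_nonneg |y|]
    have h3 : |y| ^ 5 / 100 ≤ y ^ 2 := by
      rw [← sq_abs y]
      have h5 : |y| ^ 5 ≤ |y| ^ 2 := pow_le_pow_of_le_one (abs_nonneg y) h (by norm_num)
      linarith [sq_nonneg |y|]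
    have h4 : Real.sin y - y = (Real.sin y - (y - y ^ 3 / 6)) - y ^ 3 / 6 := by ring
    rw [h4]
    refine (abs_sub _ _).trans ?_
    linarith
  · push Not at h
    have h1 : |y| ≤ y ^ 2 := by
      rw [← sq_abs]; nlinarith
    have h2 := Real.abs_sin_le_abs (x := y)
    refine (abs_sub _ _).trans ?_
    linarith

lemma aux_m0 (q : ℕ) : ∫ t in (0:ℝ)..1, t ^ q = 1 / ((q:ℝ) + 1) := by
  simp

lemma aux_m1 (q : ℕ) : ∫ t in (0:ℝ)..1, t ^ q * (1 - t) = 1 / (((q:ℝ) + 1) * (q + 2)) := by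
  have : ∀ t : ℝ, t ^ q * (1 - t) = t ^ q - t ^ (q + 1) := fun t => by ring
  simp_rw [this]
  rw [integral_sub (by apply Continuous.intervalIntegrable; fun_prop)
    (by apply Continuous.intervalIntegrable; fun_prop)]
  rw [aux_m0, aux_m0]
  push_cast
  have h1 : (q:ℝ) + 1 ≠ 0 := by positivity
  have h2 : (q:ℝ) + 2 ≠ 0 := by positivity
  have h3 : (q:ℝ) + 1 + 1 ≠ 0 := by positivity
  field_simp
  ring

lemma aux_mS (q k : ℕ) : ∫ t in (0:ℝ)..1, t ^ q * (1 - t) ^ (k + 1) =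
    (∫ t in (0:ℝ)..1, t ^ q * (1 - t) ^ k) - ∫ t in (0:ℝ)..1, t ^ (q + 1) * (1 - t) ^ k := by
  rw [← integral_sub (by apply Continuous.intervalIntegrable; fun_prop)
    (by apply Continuous.intervalIntegrable; fun_prop)]
  congr 1
  ext t
  ring

lemma aux_m2 (q : ℕ) : ∫ t in (0:ℝ)..1, t ^ q * (1 - t) ^ 2 =
    2 / (((q:ℝ) + 1) * (q + 2) * (q + 3)) := by
  rw [aux_mS]
  simp only [pow_one]
  rw [aux_m1, aux_m1]
  push_cast
  have h1 : (q:ℝ) + 1 ≠ 0 := by positivity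
  have h2 : (q:ℝ) + 2 ≠ 0 := by positivity
  have h3 : (q:ℝ) + 3 ≠ 0 := by positivity
  rw [show (q:ℝ) + 1 + 1 = q + 2 by ring, show (q:ℝ) + 1 + 2 = q + 3 by ring]
  field_simp
  ring

lemma aux_m3 (q : ℕ) : ∫ t in (0:ℝ)..1, t ^ q * (1 - t) ^ 3 =
    6 / (((q:ℝ) + 1) * (q + 2) * (q + 3) * (q + 4)) := by
  rw [aux_mS, aux_m2, aux_m2]
  push_cast
  have h1 : (q:ℝ) + 1 ≠ 0 := by positivity
  have h2 : (q:ℝ) + 2 ≠ 0 := by positivity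
  have h3 : (q:ℝ) + 3 ≠ 0 := by positivity
  have h4 : (q:ℝ) + 4 ≠ 0 := by positivity
  rw [show (q:ℝ) + 1 + 1 = q + 2 by ring, show (q:ℝ) + 1 + 2 = q + 3 by ring,
    show (q:ℝ) + 1 + 3 = q + 4 by ring]
  field_simp
  ring

lemma aux_m4 (q : ℕ) : ∫ t in (0:ℝ)..1, t ^ q * (1 - t) ^ 4 =
    24 / (((q:ℝ) + 1) * (q + 2) * (q + 3) * (q + 4) * (q + 5)) := by
  rw [aux_mS, aux_m3, aux_m3]
  push_cast
  have h1 : (q:ℝ) + 1 ≠ 0 := by positivity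
  have h2 : (q:ℝ) + 2 ≠ 0 := by positivity
  have h3 : (q:ℝ) + 3 ≠ 0 := by positivity
  have h4 : (q:ℝ) + 4 ≠ 0 := by positivity
  have h5 : (q:ℝ) + 5 ≠ 0 := by positivity
  rw [show (q:ℝ) + 1 + 1 = q + 2 by ring, show (q:ℝ) + 1 + 2 = q + 3 by ring,
    show (q:ℝ) + 1 + 3 = q + 4 by ring, show (q:ℝ) + 1 + 4 = q + 5 by ring]
  field_simp
  ring

lemma aux_lim (a : ℝ) : Tendsto (fun p : ℕ => (p:ℝ) / (2 * p + a)) atTop (nhds (1 / 2)) := by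
  have h : Tendsto (fun p : ℕ => (1:ℝ) / (2 + a / p)) atTop (nhds (1 / (2 + 0))) :=
    tendsto_const_nhds.div (tendsto_const_nhds.add (tendsto_const_div_atTop_nhds_zero_nat a))
      (by norm_num)
  rw [add_zero] at h
  refine h.congr' ?_
  filter_upwards [eventually_gt_atTop 0] with p hp
  have : (p:ℝ) ≠ 0 := by positivity
  rw [show 2 + a / (p:ℝ) = (2 * p + a) / p by field_simp, one_div_div]

lemma aux_lim' (r : ℕ) (a : ℝ) :
    Tendsto (fun p : ℕ => (p:ℝ) / (((2 * p + r : ℕ) : ℝ) + a)) atTop (nhds (1 / 2)) := by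
  refine (aux_lim (r + a)).congr fun p => ?_
  push_cast
  ring_nf

/-- The shifted phase. -/
noncomputable def auxY (n : ℕ) (d : ℝ) (p : ℕ) (t : ℝ) : ℝ := π * n * (d / p * t - (1 - t))

lemma auxY_cont (n : ℕ) (d : ℝ) (p : ℕ) : Continuous (auxY n d p) := by
  unfold auxY; fun_prop

lemma aux_S1 (n r : ℕ) (d : ℝ) :
    Tendsto (fun p : ℕ => (p:ℝ) ^ 2 * ∫ t in (0:ℝ)..1, t ^ (2 * p + r) * auxY n d p t) atTop
      (nhds (π * n * (d / 2 - 1 / 4))) := by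
  have hl : Tendsto (fun p : ℕ => π * n * (d * ((p:ℝ) / (((2 * p + r : ℕ) : ℝ) + 2))
      - ((p:ℝ) / (((2 * p + r : ℕ) : ℝ) + 1)) * ((p:ℝ) / (((2 * p + r : ℕ) : ℝ) + 2)))) atTop
      (nhds (π * n * (d * (1 / 2) - (1 / 2) * (1 / 2)))) :=
    (((aux_lim' r 2).const_mul d).sub ((aux_lim' r 1).mul (aux_lim' r 2))).const_mul _
  rw [show π * n * (d / 2 - 1 / 4) = π * n * (d * (1 / 2) - (1 / 2) * (1 / 2)) by ring]
  refine hl.congr' ?_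
  filter_upwards [eventually_gt_atTop 0] with p hp
  have hp : (p:ℝ) ≠ 0 := by positivity
  generalize 2 * p + r = q
  have : ∀ t : ℝ, t ^ q * auxY n d p t =
      (π * n * (d / p)) * t ^ (q + 1) - (π * n) * (t ^ q * (1 - t)) := fun t => by
    unfold auxY; ring
  simp_rw [this]
  rw [integral_sub (by apply Continuous.intervalIntegrable; fun_prop)
    (by apply Continuous.intervalIntegrable; fun_prop), integral_const_mul, integral_const_mul,
    aux_m0, aux_m1]
  push_cast
  have h1 : (q:ℝ) + 1 ≠ 0 := by positivity
  have h2 : (q:ℝ) + 2 ≠ 0 := by positivity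
  rw [show (q:ℝ) + 1 + 1 = q + 2 by ring]
  field_simp

lemma aux_S2 (n r : ℕ) (d : ℝ) :
    Tendsto (fun p : ℕ => (p:ℝ) ^ 3 * ∫ t in (0:ℝ)..1, t ^ (2 * p + r) * auxY n d p t ^ 2) atTop
      (nhds ((π * n) ^ 2 * (d ^ 2 / 2 - d / 2 + 1 / 4))) := by
  have L := aux_lim' r
  have hl := ((((L 3).const_mul (d ^ 2)).sub (((L 2).mul (L 3)).const_mul (2 * d))).add
    ((((L 1).mul (L 2)).mul (L 3)).const_mul 2)).const_mul ((π * n) ^ 2)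
  rw [show (π * n) ^ 2 * (d ^ 2 / 2 - d / 2 + 1 / 4) = (π * n) ^ 2 * (d ^ 2 * (1 / 2)
    - 2 * d * (1 / 2 * (1 / 2)) + 2 * (1 / 2 * (1 / 2) * (1 / 2))) by ring]
  refine hl.congr' ?_
  filter_upwards [eventually_gt_atTop 0] with p hp
  have hp : (p:ℝ) ≠ 0 := by positivity
  generalize 2 * p + r = q
  have : ∀ t : ℝ, t ^ q * auxY n d p t ^ 2 =
      ((π * n) ^ 2 * (d / p) ^ 2) * t ^ (q + 2)
       - ((π * n) ^ 2 * (2 * (d / p))) * (t ^ (q + 1) * (1 - t))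
       + (π * n) ^ 2 * (t ^ q * (1 - t) ^ 2) := fun t => by
    unfold auxY; ring
  simp_rw [this]
  rw [integral_add (by apply Continuous.intervalIntegrable; fun_prop)
    (by apply Continuous.intervalIntegrable; fun_prop),
    integral_sub (by apply Continuous.intervalIntegrable; fun_prop)
    (by apply Continuous.intervalIntegrable; fun_prop), integral_const_mul, integral_const_mul,
    integral_const_mul, aux_m0, aux_m1, aux_m2]
  push_cast
  have h1 : (q:ℝ) + 1 ≠ 0 := by positivity
  have h2 : (q:ℝ) + 2 ≠ 0 := by positivity
  have h3 : (q:ℝ) + 3 ≠ 0 := by positivity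
  rw [show (q:ℝ) + 1 + 1 = q + 2 by ring, show (q:ℝ) + 2 + 1 = q + 3 by ring,
    show (q:ℝ) + 1 + 2 = q + 3 by ring]
  field_simp

lemma aux_S4 (n r : ℕ) (d : ℝ) :
    Tendsto (fun p : ℕ => (p:ℝ) ^ 3 * ∫ t in (0:ℝ)..1, t ^ (2 * p + r) * auxY n d p t ^ 4) atTop
      (nhds 0) := by
  have L := aux_lim' r
  have Z : Tendsto (fun p : ℕ => (1:ℝ) / p) atTop (nhds 0) :=
    tendsto_const_div_atTop_nhds_zero_nat 1
  have hl := ((((L 5).const_mul (d ^ 4)).add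
    ((((((L 1).mul (L 2)).mul (L 3)).mul (L 4)).mul (L 5)).const_mul 24)).const_mul
      (8 * (π * n) ^ 4)).mul (Z.mul Z)
  rw [mul_zero, mul_zero] at hl
  refine squeeze_zero' ?_ ?_ hl
  · refine Eventually.of_forall fun p => ?_
    refine mul_nonneg (by positivity) (integral_nonneg (by norm_num) fun t ht => ?_)
    have := ht.1
    positivity
  filter_upwards [eventually_gt_atTop 0] with p hp
  have hp0 : 0 < (p:ℝ) := by positivity
  have hp : (p:ℝ) ≠ 0 := hp0.ne'
  generalize 2 * p + r = q
  have hY := auxY_cont n d p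
  have key : ∫ t in (0:ℝ)..1, t ^ q * auxY n d p t ^ 4 ≤ ∫ t in (0:ℝ)..1,
      ((8 * (π * n) ^ 4 * (d / p) ^ 4) * t ^ (q + 4)
       + (8 * (π * n) ^ 4) * (t ^ q * (1 - t) ^ 4)) := by
    refine integral_mono_on (by norm_num) (by apply Continuous.intervalIntegrable; fun_prop)
      (by apply Continuous.intervalIntegrable; fun_prop) fun t ht => ?_
    have h0 : ∀ a b : ℝ, (a - b) ^ 4 ≤ 8 * (a ^ 4 + b ^ 4) := fun a b => by
      have e1 : (a - b) ^ 2 ≤ 2 * (a ^ 2 + b ^ 2) := by nlinarith [sq_nonneg (a + b)]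
      have e2 : ((a - b) ^ 2) ^ 2 ≤ (2 * (a ^ 2 + b ^ 2)) ^ 2 :=
        pow_le_pow_left₀ (sq_nonneg _) e1 2
      nlinarith [sq_nonneg (a ^ 2 - b ^ 2)]
    have h1 := h0 (d / p * t) (1 - t)
    have h2 : 0 ≤ t ^ q * (π * n) ^ 4 := by
      have := ht.1
      positivity
    have h3 := mul_le_mul_of_nonneg_left h1 h2
    unfold auxY
    calc _ = t ^ q * (π * n) ^ 4 * (d / p * t - (1 - t)) ^ 4 := by ring
      _ ≤ _ := h3
      _ = _ := by ring
  refine (mul_le_mul_of_nonneg_left key (by positivity)).trans (le_of_eq ?_)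
  rw [integral_add (by apply Continuous.intervalIntegrable; fun_prop)
    (by apply Continuous.intervalIntegrable; fun_prop), integral_const_mul, integral_const_mul,
    aux_m0, aux_m4]
  push_cast
  have h1 : (q:ℝ) + 1 ≠ 0 := by positivity
  have h2 : (q:ℝ) + 2 ≠ 0 := by positivity
  have h3 : (q:ℝ) + 3 ≠ 0 := by positivity
  have h4 : (q:ℝ) + 4 ≠ 0 := by positivity
  have h5 : (q:ℝ) + 5 ≠ 0 := by positivity
  rw [show (q:ℝ) + 4 + 1 = q + 5 by ring]
  field_simp

/-- Comparison of integrals. -/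
lemma aux_cmp (q : ℕ) (f g : ℝ → ℝ) (hf : Continuous f) (hg : Continuous g)
    (h : ∀ t, |f t| ≤ g t) :
    |∫ t in (0:ℝ)..1, t ^ q * f t| ≤ ∫ t in (0:ℝ)..1, t ^ q * g t := by
  refine (abs_integral_le_integral_abs (by norm_num)).trans ?_
  refine integral_mono_on (by norm_num) (by apply Continuous.intervalIntegrable; fun_prop)
      (by apply Continuous.intervalIntegrable; fun_prop) fun t ht => ?_
  rw [abs_mul, abs_of_nonneg (pow_nonneg ht.1 q)]
  exact mul_le_mul_of_nonneg_left (h t) (pow_nonneg ht.1 q)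

lemma aux_C (n r : ℕ) (d : ℝ) :
    Tendsto (fun p : ℕ => (p:ℝ) ^ 3 *
      ∫ t in (0:ℝ)..1, t ^ (2 * p + r) * (1 - Real.cos (auxY n d p t))) atTop
      (nhds ((π * n) ^ 2 * (d ^ 2 / 2 - d / 2 + 1 / 4) / 2)) := by
  have h2 := (aux_S2 n r d).div_const 2
  have h4 := (aux_S4 n r d).div_const 2
  rw [zero_div] at h4
  have h5 : Tendsto (fun p : ℕ => (p:ℝ) ^ 3 * ∫ t in (0:ℝ)..1, t ^ (2 * p + r) *
      (1 - Real.cos (auxY n d p t) - auxY n d p t ^ 2 / 2)) atTop (nhds 0) := by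
    refine squeeze_zero_norm (fun p => ?_) h4
    have hY := auxY_cont n d p
    rw [Real.norm_eq_abs, abs_mul, abs_of_nonneg (by positivity), mul_div_assoc]
    refine mul_le_mul_of_nonneg_left ?_ (by positivity)
    rw [← integral_div]
    simp_rw [mul_div_assoc]
    exact aux_cmp _ _ _ (by fun_prop) (by fun_prop) fun t => aux_cos_bound _
  have h6 := h5.add h2
  rw [zero_add] at h6
  refine h6.congr fun p => ?_
  have hY := auxY_cont n d p
  rw [mul_div_assoc, ← mul_add, ← integral_div, ← integral_add
    (by apply Continuous.intervalIntegrable; fun_prop)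
    (by apply Continuous.intervalIntegrable; fun_prop)]
  congr 2
  ext t
  ring

lemma aux_Sn (n r : ℕ) (d : ℝ) :
    Tendsto (fun p : ℕ => (p:ℝ) ^ 2 *
      ∫ t in (0:ℝ)..1, t ^ (2 * p + r) * Real.sin (auxY n d p t)) atTop
      (nhds (π * n * (d / 2 - 1 / 4))) := by
  have h1 := aux_S1 n r d
  have Z : Tendsto (fun p : ℕ => (2:ℝ) / p) atTop (nhds 0) :=
    tendsto_const_div_atTop_nhds_zero_nat 2
  have h2 := Z.mul (aux_S2 n r d)
  rw [zero_mul] at h2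
  have h5 : Tendsto (fun p : ℕ => (p:ℝ) ^ 2 * ∫ t in (0:ℝ)..1, t ^ (2 * p + r) *
      (Real.sin (auxY n d p t) - auxY n d p t)) atTop (nhds 0) := by
    refine squeeze_zero_norm' ?_ h2
    filter_upwards [eventually_gt_atTop 0] with p hp
    have hp : (p:ℝ) ≠ 0 := by positivity
    have hY := auxY_cont n d p
    rw [Real.norm_eq_abs, abs_mul, abs_of_nonneg (by positivity),
      show ∀ I : ℝ, 2 / (p:ℝ) * ((p:ℝ) ^ 3 * I) = (p:ℝ) ^ 2 * (2 * I) by intro I; field_simp]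
    refine mul_le_mul_of_nonneg_left ?_ (by positivity)
    rw [← integral_const_mul]
    simp_rw [mul_left_comm (2:ℝ)]
    exact aux_cmp _ _ _ (by fun_prop) (by fun_prop) fun t => aux_sin_bound _
  have h6 := h5.add h1
  rw [zero_add] at h6
  refine h6.congr fun p => ?_
  have hY := auxY_cont n d p
  rw [← mul_add, ← integral_add
    (by apply Continuous.intervalIntegrable; fun_prop)
    (by apply Continuous.intervalIntegrable; fun_prop)]
  congr 2
  ext t
  ring

lemma aux_phase (n p : ℕ) (u t : ℝ) :
    π * ((n : ℝ) * (1 + 1 / (2 * p) + u / p)) * t = auxY n (1 / 2 + u) p t + n * π := by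
  unfold auxY
  rw [show (1:ℝ) / (2 * p) = 1 / 2 / p by rw [div_div]]
  ring

lemma aux_cosint (n p q : ℕ) (u : ℝ) :
    ∫ t in (0 : ℝ)..1, Real.cos (π * ((n : ℝ) * (1 + 1 / (2 * p) + u / p)) * t) * t ^ q
    = (-1) ^ n * (1 / ((q:ℝ) + 1)
      - ∫ t in (0:ℝ)..1, t ^ q * (1 - Real.cos (auxY n (1 / 2 + u) p t))) := by
  have hY := auxY_cont n (1 / 2 + u) p
  rw [← aux_m0, ← integral_sub
    (by apply Continuous.intervalIntegrable; fun_prop)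
    (by apply Continuous.intervalIntegrable; fun_prop), ← integral_const_mul]
  congr 1
  ext t
  rw [aux_phase, Real.cos_add_nat_mul_pi]
  ring

lemma aux_sinint (n p q : ℕ) (u : ℝ) :
    ∫ t in (0 : ℝ)..1, Real.sin (π * ((n : ℝ) * (1 + 1 / (2 * p) + u / p)) * t) * t ^ q
    = (-1) ^ n * ∫ t in (0:ℝ)..1, t ^ q * Real.sin (auxY n (1 / 2 + u) p t) := by
  rw [← integral_const_mul]
  congr 1
  ext t
  rw [aux_phase, Real.sin_add_nat_mul_pi]
  ring

/-- The final limit, from abstract asymptotics. -/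
lemma aux_final (n : ℕ) (hn : 1 ≤ n) (u e : ℝ) (he : e = 1 ∨ e = -1) (g1 g2 D3 S D5 h5 : ℕ → ℝ)
    (H1 : Tendsto (fun p : ℕ => (p:ℝ) * g1 p) atTop (nhds (1 / 2)))
    (H2 : Tendsto (fun p : ℕ => (p:ℝ) * g2 p) atTop (nhds (1 / 2)))
    (H5 : Tendsto (fun p : ℕ => (p:ℝ) * h5 p) atTop (nhds (1 / 2)))
    (HD3 : Tendsto (fun p : ℕ => (p:ℝ) ^ 3 * D3 p) atTop (nhds ((π * n) ^ 2 * (1 + 4 * u ^ 2) / 16)))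
    (HD5 : Tendsto (fun p : ℕ => (p:ℝ) ^ 3 * D5 p) atTop (nhds ((π * n) ^ 2 * (1 + 4 * u ^ 2) / 16)))
    (HS : Tendsto (fun p : ℕ => (p:ℝ) ^ 2 * S p) atTop (nhds (π * n * u / 2))) :
    Tendsto (fun p : ℕ =>
      let g3 : ℝ := e * (g1 p - D3 p)
      let g4 : ℝ := e * S p
      let g5 : ℝ := e * (h5 p - D5 p)
      let C : ℝ := g1 p ^ 2 - g3 ^ 2
      let A : ℝ := g2 p * C - g1 p * g4 ^ 2
      let B : ℝ := g5 * C - g3 * g4 ^ 2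
      ((n : ℝ) / p) *
        ((B * Real.arcsin (B / A) + Real.sqrt (A ^ 2 - B ^ 2)) / C ^ ((3 : ℝ) / 2)))
      atTop (nhds (1 / (1 + 4 * u ^ 2) ^ ((3 : ℝ) / 2))) := by
  have hn0 : (0:ℝ) < n := by exact_mod_cast hn
  have he2 : e ^ 2 = 1 := by rcases he with h | h <;> rw [h] <;> norm_num
  have Z : Tendsto (fun p : ℕ => (1:ℝ) / p) atTop (nhds 0) :=
    tendsto_const_div_atTop_nhds_zero_nat 1
  set K : ℝ := (π * n) ^ 2 * (1 + 4 * u ^ 2) / 16 with hK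
  have hKpos : 0 < K := by rw [hK]; have := Real.pi_pos; positivity
  -- g3, g5
  have HD3' := (HD3.mul Z).mul Z
  have HD5' := (HD5.mul Z).mul Z
  have HG3 := (H1.sub HD3').const_mul e
  have HG5 := (H5.sub HD5').const_mul e
  have HC := HD3.mul (H1.add (H1.sub HD3'))
  have HG4 := HS.const_mul e
  have HA := (H2.mul HC).sub (H1.mul (HG4.pow 2))
  have HB := (HG5.mul HC).sub (HG3.mul (HG4.pow 2))
  set N : ℝ := (π * n) ^ 2 / 32 with hN
  have hNpos : 0 < N := by rw [hN]; have := Real.pi_pos; positivity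
  have eC : K * (1 / 2 + (1 / 2 - K * 0 * 0)) = K := by ring
  have eA : 1 / 2 * (K * (1 / 2 + (1 / 2 - K * 0 * 0))) - 1 / 2 * (e * (π * n * u / 2)) ^ 2
      = N := by
    rw [mul_pow, he2, hK, hN]; ring
  have eB : e * (1 / 2 - K * 0 * 0) * (K * (1 / 2 + (1 / 2 - K * 0 * 0))) -
      e * (1 / 2 - K * 0 * 0) * (e * (π * n * u / 2)) ^ 2 = e * N := by
    rw [mul_pow, he2, hK, hN]; ring
  rw [eA] at HA
  rw [eB] at HB
  rw [eC] at HC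
  have HBA := HB.div HA hNpos.ne'
  have HArc := (Real.continuous_arcsin.tendsto _).comp HBA
  have HSq := (Real.continuous_sqrt.tendsto _).comp ((HA.pow 2).sub (HB.pow 2))
  have HCp := HC.rpow_const (p := (3:ℝ)/2) (Or.inl hKpos.ne')
  have hKp : 0 < K ^ ((3:ℝ)/2) := Real.rpow_pos_of_pos hKpos _
  have HF := (((HB.mul HArc).add HSq).div HCp hKp.ne').const_mul (n:ℝ)
  have eF : (n:ℝ) * ((e * N * Real.arcsin (e * N / N) + Real.sqrt (N ^ 2 - (e * N) ^ 2))
      / K ^ ((3:ℝ)/2)) = 1 / (1 + 4 * u ^ 2) ^ ((3 : ℝ) / 2) := by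
    have e1 : e * N * Real.arcsin (e * N / N) = N * (π / 2) := by
      rw [mul_div_assoc, div_self hNpos.ne', mul_one]
      rcases he with h | h <;> rw [h] <;> simp
    have e2 : N ^ 2 - (e * N) ^ 2 = 0 := by rw [mul_pow, he2]; ring
    have hv : 0 < 1 + 4 * u ^ 2 := by positivity
    have hq : 0 ≤ π * n / 4 := by have := Real.pi_pos; positivity
    have e3 : K ^ ((3:ℝ)/2) = (π * n / 4) ^ 3 * (1 + 4 * u ^ 2) ^ ((3:ℝ)/2) := by
      rw [hK, show (π * n) ^ 2 * (1 + 4 * u ^ 2) / 16 = (π * n / 4) ^ 2 * (1 + 4 * u ^ 2) by ring,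
        Real.mul_rpow (by positivity) hv.le, ← Real.rpow_natCast_mul hq]
      congr 1
      rw [← Real.rpow_natCast]
      norm_num
    have hvp : 0 < (1 + 4 * u ^ 2) ^ ((3:ℝ)/2) := Real.rpow_pos_of_pos hv _
    rw [e1, e2, e3, Real.sqrt_zero, hN]
    have := Real.pi_pos
    field_simp
    ring
  rw [eF] at HF
  have HCpos := HC.eventually_const_lt hKpos
  refine HF.congr' ?_
  filter_upwards [eventually_gt_atTop 0, HCpos] with p hp hCp
  have hp0 : 0 < (p:ℝ) := by positivity
  have hp : (p:ℝ) ≠ 0 := hp0.ne'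
  simp only [Function.comp, Pi.div_apply]
  set g3 : ℝ := e * (g1 p - D3 p) with hg3
  set g4 : ℝ := e * S p with hg4
  set g5 : ℝ := e * (h5 p - D5 p) with hg5
  set C : ℝ := g1 p ^ 2 - g3 ^ 2 with hC
  set A : ℝ := g2 p * C - g1 p * g4 ^ 2 with hA
  set B : ℝ := g5 * C - g3 * g4 ^ 2 with hB
  have c3 : e * ((p:ℝ) * g1 p - (p:ℝ) ^ 3 * D3 p * (1 / p) * (1 / p)) = p * g3 := by
    rw [hg3]; field_simp
  have c5 : e * ((p:ℝ) * h5 p - (p:ℝ) ^ 3 * D5 p * (1 / p) * (1 / p)) = p * g5 := by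
    rw [hg5]; field_simp
  have c4 : e * ((p:ℝ) ^ 2 * S p) = p ^ 2 * g4 := by rw [hg4]; ring
  have cC : (p:ℝ) ^ 3 * D3 p * (p * g1 p + (p * g1 p - (p:ℝ) ^ 3 * D3 p * (1 / p) * (1 / p)))
      = p ^ 4 * C := by
    rw [hC, hg3, mul_pow, he2]; field_simp; ring
  rw [cC] at hCp
  have hC0 : 0 < C := pos_of_mul_pos_right hCp (by positivity)
  rw [c3, c5, c4, cC]
  have cA : (p:ℝ) * g2 p * (p ^ 4 * C) - p * g1 p * (p ^ 2 * g4) ^ 2 = p ^ 5 * A := by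
    rw [hA]; ring
  have cB : (p:ℝ) * g5 * (p ^ 4 * C) - p * g3 * (p ^ 2 * g4) ^ 2 = p ^ 5 * B := by
    rw [hB]; ring
  rw [cA, cB]
  rw [mul_div_mul_left _ _ (pow_ne_zero 5 hp)]
  have cs : Real.sqrt ((p ^ 5 * A) ^ 2 - (p ^ 5 * B) ^ 2)
      = p ^ 5 * Real.sqrt (A ^ 2 - B ^ 2) := by
    rw [show ((p:ℝ) ^ 5 * A) ^ 2 - (p ^ 5 * B) ^ 2 = (p ^ 5) ^ 2 * (A ^ 2 - B ^ 2) by ring,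
      Real.sqrt_mul (by positivity), Real.sqrt_sq (by positivity)]
  have cr : ((p:ℝ) ^ 4 * C) ^ ((3:ℝ)/2) = p ^ 6 * C ^ ((3:ℝ)/2) := by
    have hsplit : ((p:ℝ) ^ 4) ^ ((3:ℝ)/2) = p ^ 6 := by
      rw [← Real.rpow_natCast_mul hp0.le, ← Real.rpow_natCast]
      norm_num
    rw [← hsplit]
    exact Real.mul_rpow (by positivity) hC0.le
  rw [cs, cr]
  generalize C ^ ((3:ℝ)/2) = X
  by_cases hX : X = 0
  · rw [hX]; simp
  field_simp

theorem pair_correlation_peak_shape (n : ℕ) (hn : 1 ≤ n) (u : ℝ) :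
    Tendsto (fun p : ℕ =>
      let x : ℝ := (n : ℝ) * (1 + 1 / (2 * p) + u / p)
      let g1 : ℝ := 1 / (2 * (p : ℝ) + 1)
      let g2 : ℝ := 1 / (2 * (p : ℝ) + 3)
      let g3 : ℝ := ∫ t in (0 : ℝ)..1, Real.cos (π * x * t) * t ^ (2 * p)
      let g4 : ℝ := ∫ t in (0 : ℝ)..1, Real.sin (π * x * t) * t ^ (2 * p + 1)
      let g5 : ℝ := ∫ t in (0 : ℝ)..1, Real.cos (π * x * t) * t ^ (2 * p + 2)
      let C : ℝ := g1 ^ 2 - g3 ^ 2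
      let A : ℝ := g2 * C - g1 * g4 ^ 2
      let B : ℝ := g5 * C - g3 * g4 ^ 2
      ((n : ℝ) / p) *
        ((B * Real.arcsin (B / A) + Real.sqrt (A ^ 2 - B ^ 2)) / C ^ ((3 : ℝ) / 2)))
      atTop (nhds (1 / (1 + 4 * u ^ 2) ^ ((3 : ℝ) / 2))) := by
  have eK : (π * n) ^ 2 * ((1 / 2 + u) ^ 2 / 2 - (1 / 2 + u) / 2 + 1 / 4) / 2
      = (π * n) ^ 2 * (1 + 4 * u ^ 2) / 16 := by ring
  have eS : π * n * ((1 / 2 + u) / 2 - 1 / 4) = π * n * u / 2 := by ring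
  have h0 := aux_C n 0 (1 / 2 + u)
  have h2 := aux_C n 2 (1 / 2 + u)
  have h1 := aux_Sn n 1 (1 / 2 + u)
  rw [eK] at h0 h2
  rw [eS] at h1
  have hm := aux_final n hn u ((-1) ^ n) (neg_one_pow_eq_or ℝ n)
    (fun p => 1 / (2 * (p:ℝ) + 1)) (fun p => 1 / (2 * (p:ℝ) + 3)) _ _ _
    (fun p => 1 / (2 * (p:ℝ) + 3))
    ((aux_lim 1).congr fun p => by ring) ((aux_lim 3).congr fun p => by ring)
    ((aux_lim 3).congr fun p => by ring) h0 h2 h1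
  refine hm.congr fun p => ?_
  simp only [aux_cosint, aux_sinint]
  push_cast
  simp only [add_zero]
  rw [show 2 * (p:ℝ) + 2 + 1 = 2 * p + 3 by ring]
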